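/- Let M be a unary homogenizable structure over a finite relational vocabulary and let ā, b̄ ∈ M be finite tuples. If both tp(ā) and tp(b̄) are isolated by quantifier-free formulas, then tp(āb̄) is isolated by a quantifier-free formula. -/

import Mathlib

open FirstOrder FirstOrder.Language CategoryTheory

namespace HomPaper

/-- The language consisting of `n` new relation symbols, the `i`-th of arity `k i`. -/
def expLang (n : ℕ) (k : Fin n → ℕ) : FirstOrder.Language.{0, 0} where
  Functions := fun _ => Empty
  Relations := fun m => {i : Fin n // k i = m}

variable (L : FirstOrder.Language.{0, 0})

/-- The interpretation of the new relation symbols: the `i`-th symbol is interpreted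
by the set defined by the formula `φ i`. -/
def expStructure (M : Type) [L.Structure M] {n : ℕ} {k : Fin n → ℕ}
    (φ : ∀ i : Fin n, L.Formula (Fin (k i))) : (expLang n k).Structure M where
  funMap := fun f _ => f.elim
  RelMap := fun {m} r x => (φ r.1).Realize (x ∘ Fin.cast r.2)

/-- `φ` is a family of homogenizing formulas for `M`: the expansion of `M` by new relation
symbols interpreted by the sets defined by the `φ i` is a homogeneous structure. -/
def Homogenizes (M : Type) [L.Structure M] {n : ℕ} {k : Fin n → ℕ}
    (φ : ∀ i : Fin n, L.Formula (Fin (k i))) : Prop :=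
  letI : (expLang n k).Structure M := expStructure L M φ
  (L.sum (expLang n k)).IsUltrahomogeneous M

/-- `M` is homogenizable. -/
def Homogenizable (M : Type) [L.Structure M] : Prop :=
  ∃ (n : ℕ) (k : Fin n → ℕ) (φ : ∀ i : Fin n, L.Formula (Fin (k i))),
    Homogenizes L M φ

/-- A `Σ₁`-formula: an existentially quantified quantifier-free formula. -/
def IsSigma1 {α : Type} (φ : L.Formula α) : Prop :=
  ∃ (m : ℕ) (ψ : L.BoundedFormula α m), ψ.IsQF ∧ φ = ψ.exs

/-- `M` is `Σ₁`-homogenizable: homogenizable with `Σ₁` homogenizing formulas. -/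
def Sigma1Homogenizable (M : Type) [L.Structure M] : Prop :=
  ∃ (n : ℕ) (k : Fin n → ℕ) (φ : ∀ i : Fin n, L.Formula (Fin (k i))),
    (∀ i, IsSigma1 L (φ i)) ∧ Homogenizes L M φ

/-- `M` is unary homogenizable: homogenizable with homogenizing formulas having
exactly one free variable. -/
def UnaryHomogenizable (M : Type) [L.Structure M] : Prop :=
  ∃ (n : ℕ) (φ : ∀ _ : Fin n, L.Formula (Fin 1)),
    Homogenizes L M (k := fun _ => 1) φ

/-- Two tuples have the same complete type over `∅`. -/
def SameType (M : Type) [L.Structure M] {m : ℕ} (a b : Fin m → M) : Prop :=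
  ∀ φ : L.Formula (Fin m), φ.Realize a ↔ φ.Realize b

/-- The complete type of the tuple `a` over `∅` is isolated by a quantifier-free formula. -/
def QFIsolated (M : Type) [L.Structure M] {m : ℕ} (a : Fin m → M) : Prop :=
  ∃ φ : L.Formula (Fin m), φ.IsQF ∧ φ.Realize a ∧
    ∀ b : Fin m → M, φ.Realize b → SameType L M a b

/-- `M` is boundedly homogenizable. -/
def BoundedlyHomogenizable (M : Type) [L.Structure M] : Prop :=
  Homogenizable L M ∧
    ∀ (p : ℕ) (a : Fin p → M), ∃ (q : ℕ) (b : Fin q → M),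
      QFIsolated L M (Fin.append a b)

/-- `M` is uniformly homogenizable. -/
def UniformlyHomogenizable (M : Type) [L.Structure M] : Prop :=
  Homogenizable L M ∧
    ∃ (p : ℕ) (a : Fin p → M), ∀ (q : ℕ) (b : Fin q → M),
      QFIsolated L M (Fin.append a b)

/-- `M` is `k`-unavoidably homogenizable: every complete `n`-type with `n ≥ k` is isolated by
a quantifier-free formula. -/
def KUnavoidablyHomogenizable (M : Type) [L.Structure M] (k : ℕ) : Prop :=
  ∀ n : ℕ, k ≤ n → ∀ a : Fin n → M, QFIsolated L M a

/-- `M` is unavoidably homogenizable. -/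
def UnavoidablyHomogenizable (M : Type) [L.Structure M] : Prop :=
  ∃ k : ℕ, KUnavoidablyHomogenizable L M k

/-- The age of `M`: the class of all finite structures embeddable into `M`
(i.e. all finite substructures of `M`, up to isomorphism). -/
def FinAge (M : Type) [L.Structure M] : Set (Bundled.{0} L.Structure) :=
  {N | Finite N ∧ Nonempty (N ↪[L] M)}

/-- The pair of embeddings `f`, `g` has an amalgam in the class `K`. -/
def HasAmalgam (K : Set (Bundled.{0} L.Structure)) {A B C : Type}
    [L.Structure A] [L.Structure B] [L.Structure C]
    (f : A ↪[L] B) (g : A ↪[L] C) : Prop :=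
  ∃ D ∈ K, ∃ (f0 : B ↪[L] D) (g0 : C ↪[L] D), ∀ x : A, f0 (f x) = g0 (g x)

/-- `A` is an amalgamation base for the class `K`. -/
def IsAmalgamationBase (K : Set (Bundled.{0} L.Structure)) (A : Type) [L.Structure A] : Prop :=
  ∀ B C : Bundled.{0} L.Structure, B ∈ K → C ∈ K →
    ∀ (f : A ↪[L] B) (g : A ↪[L] C), HasAmalgam L K f g

/-- The class `K` satisfies `SEAP_{k,m}`. -/
def SEAPAt (K : Set (Bundled.{0} L.Structure)) (k m : ℕ) : Prop :=
  ∀ A B C : Bundled.{0} L.Structure, A ∈ K → B ∈ K → C ∈ K →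
    ∀ (f : A ↪[L] B) (g : A ↪[L] C), ¬ HasAmalgam L K f g →
      ∃ A0 : L.Substructure A, Nat.card A0 < k ∧
      ∃ B0 ∈ K, ∃ C0 ∈ K, ∃ (eB : B ↪[L] B0) (eC : C ↪[L] C0),
        Nat.card B0 - Nat.card B < m ∧ Nat.card C0 - Nat.card C < m ∧
        ¬ HasAmalgam L K ((eB.comp f).comp A0.subtype) ((eC.comp g).comp A0.subtype)

/-- The class `K` satisfies SEAP. -/
def SEAP (K : Set (Bundled.{0} L.Structure)) : Prop :=
  ∃ k m : ℕ, SEAPAt L K k m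

/-- `M` is ω-categorical: `Th(M)` has exactly one countable model up to isomorphism. -/
def OmegaCategorical (M : Type) [L.Structure M] : Prop :=
  ∀ N₁ N₂ : ((L.completeTheory M).ModelType : Type 1),
    Countable N₁ → Countable N₂ → Nonempty (N₁ ≃[L] N₂)

/-- `M` is model-complete: every embedding between models of `Th(M)` is elementary. -/
def ModelComplete (M : Type) [L.Structure M] : Prop :=
  ∀ (N₁ N₂ : ((L.completeTheory M).ModelType : Type 1)) (f : N₁ ↪[L] N₂)
    (p : ℕ) (φ : L.Formula (Fin p)) (x : Fin p → N₁),
    φ.Realize (fun i => f (x i)) ↔ φ.Realize x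


/-- `M` is ω-saturated: every type over a finite tuple of parameters from `M` which is
consistent with `Th(M)` (equivalently, finitely realized in `M`) is realized in `M`. -/
def OmegaSaturated (M : Type) [L.Structure M] : Prop :=
  ∀ (p : ℕ) (c : Fin p → M) (S : Set (L.Formula (Fin (p + 1)))),
    (∀ s : Finset (L.Formula (Fin (p + 1))), ↑s ⊆ S →
      ∃ a : M, ∀ φ ∈ s, φ.Realize (Fin.snoc c a)) →
    ∃ a : M, ∀ φ ∈ S, φ.Realize (Fin.snoc c a)

/-- `M` is ω-stable: over every countable parameter set there are at most countably many
complete types. -/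
def OmegaStable (M : Type) [L.Structure M] : Prop :=
  ∀ A : Set M, A.Countable →
    ∀ p : ℕ, Countable ((L[[↥A]].completeTheory M).CompleteType (Fin p))

/-- The complete type of `a` is isolated by a conjunction of (relabelings of) the
homogenizing formulas `φ` and quantifier-free formulas. -/
def IsolatedByHomConj (M : Type) [L.Structure M] {n : ℕ} {k : Fin n → ℕ}
    (φ : ∀ i : Fin n, L.Formula (Fin (k i))) {p : ℕ} (a : Fin p → M) : Prop :=
  ∃ ψ : L.Formula (Fin p), ψ.IsQF ∧
    ∃ ts : List (Σ i : Fin n, Fin (k i) → Fin p),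
      (ψ.Realize a ∧ ∀ t ∈ ts, ((φ t.1).relabel t.2).Realize a) ∧
      ∀ b : Fin p → M,
        (ψ.Realize b ∧ ∀ t ∈ ts, ((φ t.1).relabel t.2).Realize b) → SameType L M a b

/-- `a` and `b` realize the same type over the parameter set `X`. -/
def EqTypeOver (M : Type) [L.Structure M] (X : Set M) (a b : M) : Prop :=
  ∀ (p : ℕ) (c : Fin p → M), Set.range c ⊆ X →
    ∀ φ : L.Formula (Fin (p + 1)), φ.Realize (Fin.snoc c a) ↔ φ.Realize (Fin.snoc c b)

/-- The algebraic closure in `M` is degenerate: `acl(X) = X` for every `X ⊆ M`. -/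
def DegenerateAcl (M : Type) [L.Structure M] : Prop :=
  ∀ (X : Set M) (a : M), {b : M | EqTypeOver L M X a b}.Finite → a ∈ X

/-- The induced structure on a subset of a structure for a relational language. -/
def inducedStructure (M : Type) [L.Structure M] [L.IsRelational] (A : Set M) :
    L.Structure A where
  funMap := fun f _ => isEmptyElim f
  RelMap := fun r x => Structure.RelMap r fun i => (x i : M)

/-- Elements `a` and `b` satisfy the same atomic formulas in one free variable
(the same atomic diagram). -/
def SameAtomic1 (M : Type) [L.Structure M] (a b : M) : Prop :=
  ∀ φ : L.Formula (Fin 1), φ.IsAtomic →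
    (φ.Realize (fun _ => a) ↔ φ.Realize (fun _ => b))

/-- `M` has uniformly homogenizing formulas. -/
def HasUniformlyHomogenizingFormulas (M : Type) [L.Structure M] : Prop :=
  ∃ (n : ℕ) (k m : Fin n → ℕ)
    (ψ : ∀ i : Fin n, L.BoundedFormula (Fin (k i)) (m i)),
    (∀ i, (ψ i).IsQF) ∧ Homogenizes L M (fun i => (ψ i).exs) ∧
    ∀ i, ∃ w : Fin (m i) → M, ∀ y : Fin (k i) → M,
      (∃ w0 : Fin (m i) → M, (ψ i).Realize y w0) → (ψ i).Realize y w

end HomPaper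

namespace HomPaper

section Helpers

variable {L : FirstOrder.Language.{0, 0}} {M : Type} [L.Structure M]

theorem isQF_iInf {α β : Type} [Finite β] {f : β → L.Formula α} (hf : ∀ i, (f i).IsQF) :
    (Formula.iInf f).IsQF := by
  have foldr_inf : ∀ l : List (L.BoundedFormula α 0), (∀ φ ∈ l, φ.IsQF) →
      (l.foldr (· ⊓ ·) ⊤).IsQF := by
    intro l hl
    induction l with
    | nil => exact BoundedFormula.IsQF.top
    | cons φ l ih =>
      exact (hl φ (by simp)).inf (ih fun ψ hψ => hl ψ (by simp [hψ]))
  refine foldr_inf _ fun φ hφ => ?_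
  obtain ⟨i, -, rfl⟩ := List.mem_map.1 hφ
  exact hf i

/-- The truth values of finitely many quantifier-free formulas at a tuple are described by a
single quantifier-free formula. -/
theorem exists_isQF_realize_iff {α β : Type} [Finite β] (f : β → L.Formula α)
    (hf : ∀ i, (f i).IsQF) (c : α → M) :
    ∃ χ : L.Formula α, χ.IsQF ∧ χ.Realize c ∧
      ∀ d : α → M, χ.Realize d → ∀ i, (f i).Realize c ↔ (f i).Realize d := by
  classical
  refine ⟨Formula.iInf fun i => if (f i).Realize c then f i else (f i).not,
    isQF_iInf fun i => ?_, Formula.realize_iInf.2 fun i => ?_, fun d hd i => ?_⟩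
  · split_ifs
    exacts [hf i, (hf i).not]
  · split_ifs with h
    exacts [h, Formula.realize_not.2 h]
  · have hi := Formula.realize_iInf.1 hd i
    split_ifs at hi with h
    exacts [iff_of_true h hi, iff_of_false h (Formula.realize_not.1 hi)]

/-- In a finite relational language, the atomic diagram of a finite tuple is described by a
quantifier-free formula. -/
theorem exists_isQF_atomic_diagram [Finite (Σ n : ℕ, L.Relations n)] {m : ℕ} (c : Fin m → M) :
    ∃ χ : L.Formula (Fin m), χ.IsQF ∧ χ.Realize c ∧ ∀ d : Fin m → M, χ.Realize d →
      (∀ i j, c i = c j ↔ d i = d j) ∧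
      ∀ (n : ℕ) (r : L.Relations n) (t : Fin n → Fin m),
        Structure.RelMap r (c ∘ t) ↔ Structure.RelMap r (d ∘ t) := by
  let f : (Fin m × Fin m) ⊕ (Σ r : (Σ n : ℕ, L.Relations n), Fin r.1 → Fin m) →
      L.Formula (Fin m) :=
    Sum.elim (fun e => Term.equal (.var e.1) (.var e.2))
      (fun r => r.1.2.formula fun k => .var (r.2 k))
  have hf : ∀ i, (f i).IsQF := by
    rintro (e | r)
    · exact (BoundedFormula.IsAtomic.equal _ _).isQF
    · exact (BoundedFormula.IsAtomic.rel _ _).isQF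
  obtain ⟨χ, hχ, hc, h⟩ := exists_isQF_realize_iff f hf c
  refine ⟨χ, hχ, hc, fun d hd => ⟨fun i j => ?_, fun n r t => ?_⟩⟩
  · simpa [f] using h d hd (.inl (i, j))
  · simpa [f, Formula.realize_rel, Function.comp_def] using h d hd (.inr ⟨⟨n, r⟩, t⟩)

/-- In an ultrahomogeneous relational structure, tuples with the same atomic diagram are
conjugate under an automorphism. -/
theorem _root_.FirstOrder.Language.IsUltrahomogeneous.exists_equiv_comp_eq [L.IsRelational]
    (h : L.IsUltrahomogeneous M) {m : ℕ} (c d : Fin m → M)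
    (heq : ∀ i j, c i = c j ↔ d i = d j)
    (hrel : ∀ (n : ℕ) (r : L.Relations n) (t : Fin n → Fin m),
      Structure.RelMap r (c ∘ t) ↔ Structure.RelMap r (d ∘ t)) :
    ∃ g : M ≃[L] M, g ∘ c = d := by
  let S : L.Substructure M := Substructure.closure L (Set.range c)
  have mem_S : ∀ x : S, ∃ i, c i = x := fun x =>
    (Substructure.mem_closure_iff_of_isRelational L (Set.range c) (x : M)).1 x.2
  choose idx hidx using mem_S
  let f : S ↪[L] M :=
    { toFun := fun x => d (idx x)
      inj' := fun x y hxy => Subtype.ext <| by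
        rw [← hidx x, ← hidx y]
        exact (heq _ _).2 hxy
      map_fun' := fun g => isEmptyElim g
      map_rel' := fun r x => by
        refine (hrel _ r (idx ∘ x)).symm.trans ?_
        have hx : c ∘ idx ∘ x = fun i => (x i : M) := funext fun i => hidx (x i)
        rw [hx]
        rfl }
  obtain ⟨g, hg⟩ := h S (Substructure.fg_closure (Set.finite_range c)) f
  refine ⟨g, funext fun i => ?_⟩
  let x : S := ⟨c i, Substructure.subset_closure ⟨i, rfl⟩⟩
  have hgx : d (idx x) = g (c i) := DFunLike.congr_fun hg x
  exact hgx.symm.trans ((heq _ _).1 (hidx x))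

instance expLang_isRelational (n : ℕ) (k : Fin n → ℕ) : (expLang n k).IsRelational :=
  fun _ => inferInstanceAs (IsEmpty Empty)

theorem SameType.apply {m : ℕ} {a b : Fin m → M} (h : SameType L M a b) (i : Fin m)
    (φ : L.Formula (Fin 1)) : φ.Realize (fun _ => a i) ↔ φ.Realize (fun _ => b i) := by
  simpa [Formula.realize_relabel, Function.comp_def] using h (φ.relabel fun _ => i)

/-- If `M` is homogenized by unary formulas, then tuples with the same atomic diagram whose
coordinates have pairwise the same type have the same type. -/
theorem Homogenizes.sameType [L.IsRelational] {n : ℕ} {φ : Fin n → L.Formula (Fin 1)}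
    (h : Homogenizes L M (k := fun _ => 1) φ) {m : ℕ} {c d : Fin m → M}
    (heq : ∀ i j, c i = c j ↔ d i = d j)
    (hrel : ∀ (n : ℕ) (r : L.Relations n) (t : Fin n → Fin m),
      Structure.RelMap r (c ∘ t) ↔ Structure.RelMap r (d ∘ t))
    (hφ : ∀ i j, (φ i).Realize (fun _ => c j) ↔ (φ i).Realize (fun _ => d j)) :
    SameType L M c d := by
  let : (expLang n fun _ => 1).Structure M := expStructure L M φ
  have hhom : (L.sum (expLang n fun _ => 1)).IsUltrahomogeneous M := h
  obtain ⟨g, rfl⟩ := hhom.exists_equiv_comp_eq c d heq <| by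
    rintro k (r | ⟨i, rfl⟩) t
    · exact hrel k r t
    · have unary : ∀ e : Fin m → M,
          (e ∘ t) ∘ Fin.cast rfl = fun _ => e (t 0) := fun e =>
        funext fun j => congrArg (e ∘ t) (Subsingleton.elim _ _)
      change (φ i).Realize ((c ∘ t) ∘ Fin.cast rfl) ↔ (φ i).Realize ((d ∘ t) ∘ Fin.cast rfl)
      rw [unary c, unary d]
      exact hφ i (t 0)
  intro ψ
  let ι : L →ᴸ L.sum (expLang n fun _ => 1) := LHom.sumInl
  have hψ := StrongHomClass.realize_formula g (ι.onFormula ψ) (v := c)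
  rw [LHom.realize_onFormula, LHom.realize_onFormula] at hψ
  exact hψ.symm

end Helpers

/-- In a unary homogenizable structure, if `tp(ā)` and `tp(b̄)` are isolated
by quantifier-free formulas then so is `tp(āb̄)`. -/
theorem unary_qfIsolated_append
    (L : FirstOrder.Language.{0, 0}) [L.IsRelational] [Finite (Σ n : ℕ, L.Relations n)]
    (M : Type) [L.Structure M]
    (hu : UnaryHomogenizable L M)
    {p q : ℕ} (a : Fin p → M) (b : Fin q → M)
    (ha : QFIsolated L M a) (hb : QFIsolated L M b) :
    QFIsolated L M (Fin.append a b) := by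
  obtain ⟨n, φ, hφ⟩ := hu
  obtain ⟨α, hαqf, hαa, hα⟩ := ha
  obtain ⟨β, hβqf, hβb, hβ⟩ := hb
  obtain ⟨χ, hχqf, hχc, hχ⟩ := exists_isQF_atomic_diagram (L := L) (Fin.append a b)
  refine ⟨χ ⊓ (α.relabel (Fin.castAdd q) ⊓ β.relabel (Fin.natAdd p)),
    hχqf.inf ((hαqf.relabel _).inf (hβqf.relabel _)), ?_, fun d hd => ?_⟩
  · refine Formula.realize_inf.2 ⟨hχc, Formula.realize_inf.2 ⟨?_, ?_⟩⟩
    · simpa [Formula.realize_relabel, Function.comp_def] using hαa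
    · simpa [Formula.realize_relabel, Function.comp_def] using hβb
  · obtain ⟨hχd, hd⟩ := Formula.realize_inf.1 hd
    obtain ⟨hαd, hβd⟩ := Formula.realize_inf.1 hd
    obtain ⟨heq, hrel⟩ := hχ d hχd
    refine hφ.sameType heq hrel fun i j => ?_
    induction j using Fin.addCases with
    | left j => simpa using (hα _ (Formula.realize_relabel.1 hαd)).apply j (φ i)
    | right j => simpa using (hβ _ (Formula.realize_relabel.1 hβd)).apply j (φ i)

end HomPaper
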